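/- arXiv:1511.07553 — 2 statements merged into one kernel-verified Lean document; each statement's English description precedes it below -/
import Mathlib

section
/- Let n ≥ 1, let g : ℝⁿ → (symmetric positive-definite n×n real matrices) be smooth, let φ : ℝ → ℝ be smooth and positive, and let γ : ℝ → ℝ^{1+n} be a smooth regular curve (∂ₓγ ≠ 0). With T the unit tangent and H = ∇_T T computed with respect to the right warped product metric G_R, the angle function Θ_R = ⟨T, ∂r⟩_{G_R} satisfies T(Θ_R) = ⟨H, ∂r⟩_{G_R} + (log φ)'(γ⁰)(1 − Θ_R²), where γ⁰ denotes the 0-th component of γ. -/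
open scoped BigOperators

noncomputable section

/-- Inner product of two vectors with respect to a metric matrix `G`. -/
def minner {m : ℕ} (G : Matrix (Fin m) (Fin m) ℝ) (u v : Fin m → ℝ) : ℝ :=
  ∑ α, ∑ β, u α * G α β * v β

/-- Norm of a vector with respect to a metric matrix `G`. -/
def mnorm {m : ℕ} (G : Matrix (Fin m) (Fin m) ℝ) (v : Fin m → ℝ) : ℝ :=
  Real.sqrt (minner G v v)

/-- Christoffel symbols `Γ^α_{βγ}` of the metric `G` at the point `p`:
`Γ^α_{βγ} = (1/2) Σ_δ (G⁻¹)^{αδ}(∂_β G_{δγ} + ∂_γ G_{δβ} − ∂_δ G_{βγ})`. -/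
def christoffel {m : ℕ} (G : (Fin m → ℝ) → Matrix (Fin m) (Fin m) ℝ)
    (p : Fin m → ℝ) (α β γ : Fin m) : ℝ :=
  (1 / 2) * ∑ δ, (G p)⁻¹ α δ *
      (fderiv ℝ (fun q => G q δ γ) p (Pi.single β 1)
        + fderiv ℝ (fun q => G q δ β) p (Pi.single γ 1)
        - fderiv ℝ (fun q => G q β γ) p (Pi.single δ 1))

/-- Unit tangent vector `T = ∂ₓc/|∂ₓc|_G` of a curve `c` with respect to the metric `G`. -/
def unitT {m : ℕ} (G : (Fin m → ℝ) → Matrix (Fin m) (Fin m) ℝ)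
    (c : ℝ → Fin m → ℝ) (x : ℝ) : Fin m → ℝ :=
  (mnorm (G (c x)) (deriv c x))⁻¹ • deriv c x

/-- Covariant derivative `∇_T V` of a vector field `V` along the curve `c`. -/
def covT {m : ℕ} (G : (Fin m → ℝ) → Matrix (Fin m) (Fin m) ℝ)
    (c V : ℝ → Fin m → ℝ) (x : ℝ) : Fin m → ℝ :=
  fun α => (mnorm (G (c x)) (deriv c x))⁻¹ *
    (deriv (fun y => V y α) x
      + ∑ β, ∑ δ, christoffel G (c x) α β δ * deriv c x β * V x δ)

/-- Mean curvature vector `H = ∇_T T` of the curve `c`. -/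
def meanCurv {m : ℕ} (G : (Fin m → ℝ) → Matrix (Fin m) (Fin m) ℝ)
    (c : ℝ → Fin m → ℝ) : ℝ → Fin m → ℝ :=
  covT G c (unitT G c)

/-- Directional derivative `T(η) = |∂ₓc|⁻¹ ∂ₓη` of a scalar function along the curve `c`. -/
def Tscal {m : ℕ} (G : (Fin m → ℝ) → Matrix (Fin m) (Fin m) ℝ)
    (c : ℝ → Fin m → ℝ) (η : ℝ → ℝ) (x : ℝ) : ℝ :=
  (mnorm (G (c x)) (deriv c x))⁻¹ * deriv η x

/-- Laplacian `Δη = T(T(η))` along the curve `c`. -/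
def lapScal {m : ℕ} (G : (Fin m → ℝ) → Matrix (Fin m) (Fin m) ℝ)
    (c : ℝ → Fin m → ℝ) (η : ℝ → ℝ) : ℝ → ℝ :=
  Tscal G c (Tscal G c η)

/-- Time covariant derivative `∇_t V` along a flow `γ`. -/
def covTime {m : ℕ} (G : (Fin m → ℝ) → Matrix (Fin m) (Fin m) ℝ)
    (γ V : ℝ → ℝ → Fin m → ℝ) (x t : ℝ) : Fin m → ℝ :=
  fun α => deriv (fun s => V x s α) t
    + ∑ β, ∑ δ, christoffel G (γ x t) α β δ * deriv (fun s => γ x s β) t * V x t δ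

/-- Left warped product metric `g + ψ²(x) dr²` on `ℝ^{1+n}` (index 0 is the circle direction). -/
def gwL {n : ℕ} (g : (Fin n → ℝ) → Matrix (Fin n) (Fin n) ℝ)
    (ψ : (Fin n → ℝ) → ℝ) (p : Fin (n + 1) → ℝ) : Matrix (Fin (n + 1)) (Fin (n + 1)) ℝ :=
  Matrix.of fun α β =>
    Fin.cases (Fin.cases ((ψ fun i => p i.succ) ^ 2) (fun _ => 0) β)
      (fun i => Fin.cases 0 (fun j => g (fun k => p k.succ) i j) β) α

/-- Right warped product metric `φ²(r) g + dr²` on `ℝ^{1+n}` (index 0 is the circle direction). -/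
def gwR {n : ℕ} (g : (Fin n → ℝ) → Matrix (Fin n) (Fin n) ℝ)
    (φ : ℝ → ℝ) (p : Fin (n + 1) → ℝ) : Matrix (Fin (n + 1)) (Fin (n + 1)) ℝ :=
  Matrix.of fun α β =>
    Fin.cases (Fin.cases 1 (fun _ => 0) β)
      (fun i => Fin.cases 0 (fun j => (φ (p 0)) ^ 2 * g (fun k => p k.succ) i j) β) α

/-- The vector `∂r = e₀` in `ℝ^{1+n}`. -/
def er (n : ℕ) : Fin (n + 1) → ℝ := Pi.single 0 1

/-- The gradient `D(log ψ)` of `log ψ` with respect to `(N, g)`, as a vector in `ℝ^{1+n}`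
with vanishing 0-th component. -/
def DlogPsi {n : ℕ} (g : (Fin n → ℝ) → Matrix (Fin n) (Fin n) ℝ)
    (ψ : (Fin n → ℝ) → ℝ) (x : Fin n → ℝ) : Fin (n + 1) → ℝ :=
  Fin.cases 0 (fun i => ∑ k, (g x)⁻¹ i k *
    fderiv ℝ (fun y => Real.log (ψ y)) x (Pi.single k 1))

/-- `|D(log ψ)|² = Σ_{k,l} (g⁻¹)^{kl} ∂_k(log ψ) ∂_l(log ψ)`. -/
def normSqDlogPsi {n : ℕ} (g : (Fin n → ℝ) → Matrix (Fin n) (Fin n) ℝ)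
    (ψ : (Fin n → ℝ) → ℝ) (x : Fin n → ℝ) : ℝ :=
  ∑ k, ∑ l, (g x)⁻¹ k l *
    fderiv ℝ (fun y => Real.log (ψ y)) x (Pi.single k 1) *
    fderiv ℝ (fun y => Real.log (ψ y)) x (Pi.single l 1)

/-- `∇_X ∂r` at the point `p`, i.e. `(∇_X ∂r)^α = Σ_β X^β Γ^α_{β0}`. -/
def covR {m : ℕ} [NeZero m] (G : (Fin m → ℝ) → Matrix (Fin m) (Fin m) ℝ)
    (p : Fin m → ℝ) (X : Fin m → ℝ) : Fin m → ℝ :=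
  fun α => ∑ β, X β * christoffel G p α β 0

/-- The angle function `Θ_L = ⟨T, ∂r⟩_{G_L}` of a flow `γ` in the left warped product. -/
def thetaL {n : ℕ} (g : (Fin n → ℝ) → Matrix (Fin n) (Fin n) ℝ)
    (ψ : (Fin n → ℝ) → ℝ) (γ : ℝ → ℝ → Fin (n + 1) → ℝ) (x t : ℝ) : ℝ :=
  minner (gwL g ψ (γ x t)) (unitT (gwL g ψ) (fun y => γ y t) x) (er n)

/-- The angle function `Θ_R = ⟨T, ∂r⟩_{G_R}` of a flow `γ` in the right warped product. -/
def thetaR {n : ℕ} (g : (Fin n → ℝ) → Matrix (Fin n) (Fin n) ℝ)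
    (φ : ℝ → ℝ) (γ : ℝ → ℝ → Fin (n + 1) → ℝ) (x t : ℝ) : ℝ :=
  minner (gwR g φ (γ x t)) (unitT (gwR g φ) (fun y => γ y t) x) (er n)

section WarpedProduct

variable {n : ℕ} (g : (Fin n → ℝ) → Matrix (Fin n) (Fin n) ℝ) (φ : ℝ → ℝ)
  (p : Fin (n + 1) → ℝ)

@[simp]
lemma gwR_zero_zero : gwR g φ p 0 0 = 1 := rfl

@[simp]
lemma gwR_zero_succ (j : Fin n) : gwR g φ p 0 j.succ = 0 := rfl

@[simp]
lemma gwR_succ_zero (i : Fin n) : gwR g φ p i.succ 0 = 0 := rfl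

@[simp]
lemma gwR_succ_succ (i j : Fin n) :
    gwR g φ p i.succ j.succ = φ (p 0) ^ 2 * g (fun k => p k.succ) i j := rfl

lemma minner_smul_smul {m : ℕ} (G : Matrix (Fin m) (Fin m) ℝ) (a : ℝ) (v : Fin m → ℝ) :
    minner G (a • v) (a • v) = a ^ 2 * minner G v v := by
  simp only [minner, Pi.smul_apply, smul_eq_mul, Finset.mul_sum]
  exact Finset.sum_congr rfl fun α _ => Finset.sum_congr rfl fun β _ => by ring

lemma minner_pos_of_posDef {m : ℕ} {G : Matrix (Fin m) (Fin m) ℝ} (hG : G.PosDef)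
    {v : Fin m → ℝ} (hv : v ≠ 0) : 0 < minner G v v := by
  have h := hG.dotProduct_mulVec_pos hv
  simpa only [minner, dotProduct, Matrix.mulVec, star_trivial, Finset.mul_sum, mul_assoc] using h

lemma minner_gwR_er (u : Fin (n + 1) → ℝ) : minner (gwR g φ p) u (er n) = u 0 := by
  simp [minner, er, Fin.sum_univ_succ]

lemma minner_gwR_self (u : Fin (n + 1) → ℝ) :
    minner (gwR g φ p) u u
      = u 0 ^ 2 + φ (p 0) ^ 2 * minner (g fun k => p k.succ) (Fin.tail u) (Fin.tail u) := by
  simp only [minner, Fin.sum_univ_succ, gwR_zero_zero, gwR_zero_succ, gwR_succ_zero,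
    gwR_succ_succ, Fin.tail, mul_zero, zero_mul, Finset.sum_const_zero, add_zero, zero_add,
    Finset.mul_sum]
  congr 1
  · ring
  · exact Finset.sum_congr rfl fun i _ => Finset.sum_congr rfl fun j _ => by ring

variable {g φ}

lemma minner_gwR_self_pos (hgpd : ∀ x, (g x).PosDef) (hφpos : ∀ r, 0 < φ r)
    {u : Fin (n + 1) → ℝ} (hu : u ≠ 0) : 0 < minner (gwR g φ p) u u := by
  rw [minner_gwR_self]
  have hφp : 0 < φ (p 0) ^ 2 := pow_pos (hφpos _) 2
  by_cases ht : Fin.tail u = 0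
  · have h0 : u 0 ≠ 0 := by
      refine fun h0 => hu (funext fun i => ?_)
      refine Fin.cases h0 (fun j => ?_) i
      exact congrFun ht j
    have : 0 < u 0 ^ 2 := by positivity
    simpa [ht, minner] using this
  · have := mul_pos hφp (minner_pos_of_posDef (hgpd fun k => p k.succ) ht)
    positivity

lemma isUnit_gwR (hgpd : ∀ x, (g x).PosDef) (hφpos : ∀ r, 0 < φ r) :
    IsUnit (gwR g φ p) := by
  rw [Matrix.isUnit_iff_isUnit_det, isUnit_iff_ne_zero]
  intro hdet
  obtain ⟨v, hv, hmul⟩ := Matrix.exists_mulVec_eq_zero_iff.2 hdet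
  have h := minner_gwR_self_pos p hgpd hφpos hv
  have h' : minner (gwR g φ p) v v = v ⬝ᵥ (gwR g φ p).mulVec v := by
    simp only [minner, dotProduct, Matrix.mulVec, Finset.mul_sum, mul_assoc]
  rw [h', hmul, dotProduct_zero] at h
  exact h.false

lemma gwR_inv_zero (hgpd : ∀ x, (g x).PosDef) (hφpos : ∀ r, 0 < φ r) (δ : Fin (n + 1)) :
    (gwR g φ p)⁻¹ 0 δ = if δ = 0 then 1 else 0 := by
  have hdet := (Matrix.isUnit_iff_isUnit_det _).1 (isUnit_gwR p hgpd hφpos)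
  have hrow : Matrix.vecMul (er n) (gwR g φ p) = er n := by
    funext β
    refine Fin.cases ?_ (fun j => ?_) β <;> simp [er]
  have h : Matrix.vecMul (er n) (gwR g φ p)⁻¹ = er n := by
    conv_lhs => rw [← hrow]
    rw [Matrix.vecMul_vecMul, Matrix.mul_nonsing_inv _ hdet, Matrix.vecMul_one]
  simpa [er, Pi.single_apply] using congrFun h δ

lemma fderiv_gwR_succ_succ (hg : ∀ i j, ContDiff ℝ (⊤ : ℕ∞) fun x => g x i j)
    (hφ : ContDiff ℝ (⊤ : ℕ∞) φ) (i j : Fin n) :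
    fderiv ℝ (fun q => gwR g φ q i.succ j.succ) p (Pi.single 0 1)
      = 2 * φ (p 0) * deriv φ (p 0) * g (fun k => p k.succ) i j := by
  have hd : DifferentiableAt ℝ (fun q => gwR g φ q i.succ j.succ) p := by
    have h1 : Differentiable ℝ φ := hφ.differentiable (by simp)
    have h2 : Differentiable ℝ fun x => g x i j := (hg i j).differentiable (by simp)
    have h3 : Differentiable ℝ fun q : Fin (n + 1) → ℝ => fun k : Fin n => q k.succ := by
      fun_prop
    have h4 : Differentiable ℝ fun q : Fin (n + 1) → ℝ => φ (q 0) :=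
      h1.comp (differentiable_apply 0)
    exact ((h4.pow 2).mul (h2.comp h3)) p
  rw [← hd.lineDeriv_eq_fderiv, lineDeriv]
  have hφd : HasDerivAt (fun t : ℝ => φ (p 0 + t)) (deriv φ (p 0)) 0 := by
    have h := (hφ.differentiable (by simp) (p 0 + 0)).hasDerivAt.comp_const_add (p 0) 0
    simpa using h
  have h := (hφd.pow 2).mul_const (g (fun k => p k.succ) i j)
  have hfun : (fun t : ℝ => gwR g φ (p + t • Pi.single 0 1) i.succ j.succ)
      = fun t => φ (p 0 + t) ^ 2 * g (fun k => p k.succ) i j := by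
    funext t
    simp
  rw [hfun]
  refine h.deriv.trans ?_
  simp

/-- The sum `Γ⁰(u, u)`, which only sees the components of `u` tangent to the slices `r = const`. -/
lemma sum_christoffel_gwR_zero (hg : ∀ i j, ContDiff ℝ (⊤ : ℕ∞) fun x => g x i j)
    (hgpd : ∀ x, (g x).PosDef) (hφ : ContDiff ℝ (⊤ : ℕ∞) φ) (hφpos : ∀ r, 0 < φ r)
    (u : Fin (n + 1) → ℝ) :
    ∑ β, ∑ δ, christoffel (gwR g φ) p 0 β δ * u β * u δ
      = -(φ (p 0) * deriv φ (p 0)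
          * minner (g fun k => p k.succ) (Fin.tail u) (Fin.tail u)) := by
  have hΓ (β δ : Fin (n + 1)) : christoffel (gwR g φ) p 0 β δ
      = -(1 / 2) * fderiv ℝ (fun q => gwR g φ q β δ) p (Pi.single 0 1) := by
    have hconst (δ : Fin (n + 1)) : fderiv ℝ (fun q => gwR g φ q 0 δ) p = 0 := by
      refine Fin.cases ?_ (fun j => ?_) δ <;> simp
    simp [christoffel, gwR_inv_zero p hgpd hφpos, hconst]
  simp only [hΓ, Fin.sum_univ_succ, fderiv_gwR_succ_succ p hg hφ]
  simp only [gwR_zero_zero, gwR_zero_succ, gwR_succ_zero, fderiv_fun_const, Pi.zero_apply,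
    zero_apply, mul_zero, zero_mul, Finset.sum_const_zero, add_zero, zero_add,
    minner, Finset.mul_sum, ← Finset.sum_neg_distrib, Fin.tail]
  exact Finset.sum_congr rfl fun i _ => Finset.sum_congr rfl fun j _ => by ring

end WarpedProduct

/-- For a regular curve in the right warped product,
`T(Θ_R) = ⟨H, ∂r⟩ + (log φ)'(γ⁰)(1 − Θ_R²)`. -/
theorem stmt10 {n : ℕ} (hn : 1 ≤ n)
    (g : (Fin n → ℝ) → Matrix (Fin n) (Fin n) ℝ)
    (hg : ∀ i j, ContDiff ℝ (⊤ : ℕ∞) fun x => g x i j)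
    (hgpd : ∀ x, (g x).PosDef)
    (φ : ℝ → ℝ) (hφ : ContDiff ℝ (⊤ : ℕ∞) φ) (hφpos : ∀ r, 0 < φ r)
    (γ : ℝ → Fin (n + 1) → ℝ) (hγ : ContDiff ℝ (⊤ : ℕ∞) γ)
    (hreg : ∀ x, deriv γ x ≠ 0) (x : ℝ) :
    Tscal (gwR g φ) γ (fun y => minner (gwR g φ (γ y)) (unitT (gwR g φ) γ y) (er n)) x
      = minner (gwR g φ (γ x)) (meanCurv (gwR g φ) γ x) (er n)
        + deriv (fun s => Real.log (φ s)) (γ x 0)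
            * (1 - (minner (gwR g φ (γ x)) (unitT (gwR g φ) γ x) (er n)) ^ 2) := by
  have hpos : 0 < minner (gwR g φ (γ x)) (deriv γ x) (deriv γ x) :=
    minner_gwR_self_pos _ hgpd hφpos (hreg x)
  set p := γ x with hp
  set N := mnorm (gwR g φ p) (deriv γ x) with hN
  have hNpos : 0 < N := Real.sqrt_pos.2 hpos
  have hunit : minner (gwR g φ p) (unitT (gwR g φ) γ x) (unitT (gwR g φ) γ x) = 1 := by
    have hsq : N ^ 2 = minner (gwR g φ p) (deriv γ x) (deriv γ x) := Real.sq_sqrt hpos.le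
    rw [unitT, ← hp, minner_smul_smul, ← hN, ← hsq]
    field_simp
  rw [minner_gwR_self] at hunit
  have hΓ := sum_christoffel_gwR_zero p hg hgpd hφ hφpos (unitT (gwR g φ) γ x)
  have hderiv : deriv γ x = N • unitT (gwR g φ) γ x := by
    rw [unitT, ← hp, ← hN, smul_inv_smul₀ hNpos.ne']
  have hsum : ∑ β, ∑ δ, christoffel (gwR g φ) p 0 β δ * deriv γ x β * unitT (gwR g φ) γ x δ
      = N * ∑ β, ∑ δ, christoffel (gwR g φ) p 0 β δ * unitT (gwR g φ) γ x β
          * unitT (gwR g φ) γ x δ := by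
    simp only [Finset.mul_sum]
    refine Finset.sum_congr rfl fun β _ => Finset.sum_congr rfl fun δ _ => ?_
    rw [congrFun hderiv β, Pi.smul_apply, smul_eq_mul]
    ring
  have hlog : deriv (fun s => Real.log (φ s)) (p 0) = deriv φ (p 0) / φ (p 0) :=
    deriv.log (hφ.differentiable (by simp) _) (hφpos _).ne'
  simp only [minner_gwR_er, Tscal, meanCurv, covT]
  rw [← hp, ← hN, hsum, hΓ, hlog, ← hunit]
  have hφ0 := (hφpos (p 0)).ne'
  field_simp
  ring

end
end

section
/- Let n ≥ 1, let g : ℝⁿ → (symmetric positive-definite n×n real matrices) be smooth, let φ : ℝ → ℝ be smooth and positive, and let γ : ℝ × [0,t₀) → ℝ^{1+n} be a curve shortening flow in local coordinates with respect to the right warped product metric G_R. Then the angle function Θ_R = ⟨T, ∂r⟩_{G_R} satisfies, at every point (x,t), the evolution equation ∂_t Θ_R = ΔΘ_R + |A|² Θ_R + 2 (log φ)'(γ⁰) Θ_R T(Θ_R) − (log φ)''(γ⁰) Θ_R (1 − Θ_R²), where γ⁰ denotes the 0-th component of γ(x,t). -/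
open scoped BigOperators

noncomputable section

/-- Directional derivative `∂_W G` of the metric matrix `G` at the point `p`. -/
def metricDeriv {m : ℕ} (G : (Fin m → ℝ) → Matrix (Fin m) (Fin m) ℝ)
    (p W : Fin m → ℝ) : Matrix (Fin m) (Fin m) ℝ :=
  Matrix.of fun α β => fderiv ℝ (fun q => G q α β) p W

/-- The Christoffel symbols as a bilinear map: `Γ(X,Y)^α = Σ_{β,δ} Γ^α_{βδ} X^β Y^δ`. -/
def christoffelVec {m : ℕ} (G : (Fin m → ℝ) → Matrix (Fin m) (Fin m) ℝ)
    (p X Y : Fin m → ℝ) : Fin m → ℝ :=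
  fun α => ∑ β, ∑ δ, christoffel G p α β δ * X β * Y δ

section Minner

open Matrix

variable {m : ℕ} (A : Matrix (Fin m) (Fin m) ℝ)

theorem minner_eq_dotProduct (u v : Fin m → ℝ) : minner A u v = u ⬝ᵥ A *ᵥ v := by
  simp only [minner, dotProduct, mulVec, Finset.mul_sum, mul_assoc]

theorem minner_add_right (u v w : Fin m → ℝ) :
    minner A u (v + w) = minner A u v + minner A u w := by
  simp [minner_eq_dotProduct, mulVec_add]

theorem minner_smul_right (a : ℝ) (u v : Fin m → ℝ) :
    minner A u (a • v) = a * minner A u v := by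
  simp [minner_eq_dotProduct, mulVec_smul]

theorem minner_smul_left (a : ℝ) (u v : Fin m → ℝ) :
    minner A (a • u) v = a * minner A u v := by
  simp [minner_eq_dotProduct]

theorem minner_smul_matrix (a : ℝ) (u v : Fin m → ℝ) :
    minner (a • A) u v = a * minner A u v := by
  simp [minner_eq_dotProduct, smul_mulVec]

variable {A}

theorem minner_comm (hA : ∀ α β, A α β = A β α) (u v : Fin m → ℝ) :
    minner A u v = minner A v u := by
  unfold minner
  rw [Finset.sum_comm]
  refine Finset.sum_congr rfl fun β _ => Finset.sum_congr rfl fun α _ => ?_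
  rw [hA α β]; ring

theorem Matrix.PosDef.apply_comm (hA : A.PosDef) (α β : Fin m) : A α β = A β α := by
  simpa using hA.isHermitian.apply β α

theorem Matrix.PosDef.minner_self_pos (hA : A.PosDef) {u : Fin m → ℝ} (hu : u ≠ 0) :
    0 < minner A u u := by
  simpa [minner_eq_dotProduct] using hA.dotProduct_mulVec_pos hu

theorem mnorm_pos (hA : A.PosDef) {u : Fin m → ℝ} (hu : u ≠ 0) : 0 < mnorm A u :=
  Real.sqrt_pos.2 (hA.minner_self_pos hu)

theorem mnorm_sq (hA : A.PosDef) {u : Fin m → ℝ} (hu : u ≠ 0) :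
    mnorm A u ^ 2 = minner A u u :=
  Real.sq_sqrt (hA.minner_self_pos hu).le

end Minner

section CurveInMetric

variable {m : ℕ} {G : (Fin m → ℝ) → Matrix (Fin m) (Fin m) ℝ}

theorem metricDeriv_smul (p W : Fin m → ℝ) (a : ℝ) :
    metricDeriv G p (a • W) = a • metricDeriv G p W := by
  ext α β
  simp [metricDeriv]

theorem metricDeriv_apply_comm (hG : ∀ p α β, G p α β = G p β α) (p W : Fin m → ℝ)
    (α β : Fin m) : metricDeriv G p W α β = metricDeriv G p W β α := by
  simp only [metricDeriv, Matrix.of_apply, hG _ α β]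

theorem metricDeriv_eq_sum (p W : Fin m → ℝ) (α β : Fin m) :
    metricDeriv G p W α β
      = ∑ δ, W δ * fderiv ℝ (fun q => G q α β) p (Pi.single δ 1) := by
  conv_lhs => rw [metricDeriv, Matrix.of_apply, pi_eq_sum_univ' W]
  rw [map_sum]
  refine Finset.sum_congr rfl fun δ _ => ?_
  rw [map_smul, smul_eq_mul]

/-- Lowering the index of the Christoffel symbols. -/
theorem minner_christoffelVec {p : Fin m → ℝ} (hp : IsUnit (G p).det) (W X Y : Fin m → ℝ) :
    minner (G p) W (christoffelVec G p X Y)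
      = (1 / 2) * (minner (metricDeriv G p X) W Y + minner (metricDeriv G p Y) W X
          - minner (metricDeriv G p W) X Y) := by
  set k : Fin m → ℝ := fun δ => ∑ β, ∑ γ, (1 / 2) *
      (fderiv ℝ (fun q => G q δ γ) p (Pi.single β 1)
        + fderiv ℝ (fun q => G q δ β) p (Pi.single γ 1)
        - fderiv ℝ (fun q => G q β γ) p (Pi.single δ 1)) * X β * Y γ with hk
  have h1 : christoffelVec G p X Y = Matrix.mulVec (G p)⁻¹ k := by
    ext α
    simp only [christoffelVec, christoffel, Matrix.mulVec, dotProduct, hk, Finset.mul_sum,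
      Finset.sum_mul]
    rw [Finset.sum_comm_cycle]
    refine Finset.sum_congr rfl fun δ _ => Finset.sum_congr rfl fun β _ =>
      Finset.sum_congr rfl fun γ _ => ?_
    ring
  rw [minner_eq_dotProduct, h1, Matrix.mulVec_mulVec, Matrix.mul_nonsing_inv _ hp,
    Matrix.one_mulVec]
  have e1 : minner (metricDeriv G p X) W Y = ∑ δ, ∑ β, ∑ γ,
      W δ * (fderiv ℝ (fun q => G q δ γ) p (Pi.single β 1) * X β * Y γ) := by
    simp only [minner, metricDeriv_eq_sum, Finset.mul_sum, Finset.sum_mul]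
    refine Finset.sum_congr rfl fun δ _ => ?_
    rw [Finset.sum_comm]
    refine Finset.sum_congr rfl fun β _ => Finset.sum_congr rfl fun γ _ => ?_
    ring
  have e2 : minner (metricDeriv G p Y) W X = ∑ δ, ∑ β, ∑ γ,
      W δ * (fderiv ℝ (fun q => G q δ β) p (Pi.single γ 1) * X β * Y γ) := by
    simp only [minner, metricDeriv_eq_sum, Finset.mul_sum, Finset.sum_mul]
    refine Finset.sum_congr rfl fun δ _ => Finset.sum_congr rfl fun β _ =>
      Finset.sum_congr rfl fun γ _ => ?_
    ring
  have e3 : minner (metricDeriv G p W) X Y = ∑ δ, ∑ β, ∑ γ,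
      W δ * (fderiv ℝ (fun q => G q β γ) p (Pi.single δ 1) * X β * Y γ) := by
    simp only [minner, metricDeriv_eq_sum, Finset.mul_sum, Finset.sum_mul]
    rw [Finset.sum_comm_cycle]
    refine Finset.sum_congr rfl fun δ _ => Finset.sum_congr rfl fun β _ =>
      Finset.sum_congr rfl fun γ _ => ?_
    ring
  rw [e1, e2, e3, ← Finset.sum_add_distrib, ← Finset.sum_sub_distrib, Finset.mul_sum]
  refine Finset.sum_congr rfl fun δ _ => ?_
  rw [hk, ← Finset.sum_add_distrib, ← Finset.sum_sub_distrib, Finset.mul_sum, Finset.mul_sum]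
  refine Finset.sum_congr rfl fun β _ => ?_
  rw [← Finset.sum_add_distrib, ← Finset.sum_sub_distrib, Finset.mul_sum, Finset.mul_sum]
  refine Finset.sum_congr rfl fun γ _ => ?_
  ring

theorem hasDerivAt_minner (hG : ∀ α β, Differentiable ℝ fun q => G q α β)
    {c u v : ℝ → Fin m → ℝ} {c' u' v' : Fin m → ℝ} {x : ℝ}
    (hc : HasDerivAt c c' x) (hu : HasDerivAt u u' x) (hv : HasDerivAt v v' x) :
    HasDerivAt (fun y => minner (G (c y)) (u y) (v y))
      (minner (metricDeriv G (c x) c') (u x) (v x)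
        + minner (G (c x)) u' (v x) + minner (G (c x)) (u x) v') x := by
  have hGc (α β) : HasDerivAt (fun y => G (c y) α β) (metricDeriv G (c x) c' α β) x :=
    (hG α β (c x)).hasFDerivAt.comp_hasDerivAt x hc
  have hu' := hasDerivAt_pi.1 hu
  have hv' := hasDerivAt_pi.1 hv
  unfold minner
  have h := HasDerivAt.fun_sum (u := Finset.univ) fun α _ =>
    HasDerivAt.fun_sum (u := Finset.univ) fun β _ => ((hu' α).mul (hGc α β)).mul (hv' β)
  refine h.congr_deriv ?_
  simp only [← Finset.sum_add_distrib]
  refine Finset.sum_congr rfl fun α _ => Finset.sum_congr rfl fun β _ => ?_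
  simp only [Pi.mul_apply]
  ring

variable {c : ℝ → Fin m → ℝ} {x : ℝ}

theorem hasDerivAt_mnorm (hG : ∀ α β, Differentiable ℝ fun q => G q α β)
    (hpd : ∀ p, (G p).PosDef) {u : ℝ → Fin m → ℝ} {c' u' : Fin m → ℝ}
    (hc : HasDerivAt c c' x) (hu : HasDerivAt u u' x) (hux : u x ≠ 0) :
    HasDerivAt (fun y => mnorm (G (c y)) (u y))
      (((1 / 2) * minner (metricDeriv G (c x) c') (u x) (u x) + minner (G (c x)) (u x) u')
        / mnorm (G (c x)) (u x)) x := by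
  have h := (hasDerivAt_minner hG hc hu hu).sqrt ((hpd (c x)).minner_self_pos hux).ne'
  refine h.congr_deriv ?_
  have hv := (mnorm_pos (hpd (c x)) hux).ne'
  rw [minner_comm (hpd (c x)).apply_comm u' (u x)]
  unfold mnorm at hv ⊢
  field_simp
  ring

theorem smul_unitT (hpd : ∀ p, (G p).PosDef) (hx : deriv c x ≠ 0) :
    deriv c x = mnorm (G (c x)) (deriv c x) • unitT G c x := by
  rw [unitT, smul_smul, mul_inv_cancel₀ (mnorm_pos (hpd _) hx).ne', one_smul]

theorem minner_unitT_self (hpd : ∀ p, (G p).PosDef) (hx : deriv c x ≠ 0) :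
    minner (G (c x)) (unitT G c x) (unitT G c x) = 1 := by
  have hv := (mnorm_pos (hpd (c x)) hx).ne'
  rw [unitT, minner_smul_left, minner_smul_right, ← mnorm_sq (hpd _) hx]
  field_simp

theorem differentiableAt_unitT (hG : ∀ α β, Differentiable ℝ fun q => G q α β)
    (hpd : ∀ p, (G p).PosDef) (hc : DifferentiableAt ℝ c x)
    (hc' : DifferentiableAt ℝ (deriv c) x) (hx : deriv c x ≠ 0) :
    DifferentiableAt ℝ (unitT G c) x :=
  ((hasDerivAt_mnorm hG hpd hc.hasDerivAt hc'.hasDerivAt hx).differentiableAt.inv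
    (mnorm_pos (hpd _) hx).ne').smul hc'

theorem meanCurv_eq (hT : DifferentiableAt ℝ (unitT G c) x) :
    meanCurv G c x = (mnorm (G (c x)) (deriv c x))⁻¹ •
      (deriv (unitT G c) x + christoffelVec G (c x) (deriv c x) (unitT G c x)) := by
  ext α
  simp only [meanCurv, covT, christoffelVec, Pi.smul_apply, Pi.add_apply, smul_eq_mul]
  rw [(hasDerivAt_pi.1 hT.hasDerivAt α).deriv]

/-- `|∂ₓc| ⟨W, H⟩ = ⟨W, ∂ₓT⟩ + ⟨W, Γ(∂ₓc, T)⟩`, with the Christoffel term lowered. -/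
theorem mnorm_mul_minner_meanCurv (hpd : ∀ p, (G p).PosDef)
    (hT : DifferentiableAt ℝ (unitT G c) x) (hx : deriv c x ≠ 0) (W : Fin m → ℝ) :
    mnorm (G (c x)) (deriv c x) * minner (G (c x)) W (meanCurv G c x)
      = minner (G (c x)) W (deriv (unitT G c) x)
        + (1 / 2) * (minner (metricDeriv G (c x) (deriv c x)) W (unitT G c x)
          + minner (metricDeriv G (c x) (unitT G c x)) W (deriv c x)
          - minner (metricDeriv G (c x) W) (deriv c x) (unitT G c x)) := by
  rw [← minner_christoffelVec ((hpd (c x)).det_pos.ne'.isUnit), meanCurv_eq hT,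
    minner_smul_right, minner_add_right, mul_inv_cancel_left₀ (mnorm_pos (hpd _) hx).ne']

theorem minner_unitT_meanCurv (hG : ∀ α β, Differentiable ℝ fun q => G q α β)
    (hpd : ∀ p, (G p).PosDef) (hc : Differentiable ℝ c) (hc' : Differentiable ℝ (deriv c))
    (hreg : ∀ y, deriv c y ≠ 0) :
    minner (G (c x)) (unitT G c x) (meanCurv G c x) = 0 := by
  have hT := differentiableAt_unitT hG hpd (hc x) (hc' x) (hreg x)
  have h1 := hasDerivAt_minner hG (hc x).hasDerivAt hT.hasDerivAt hT.hasDerivAt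
  have h0 : (fun y => minner (G (c y)) (unitT G c y) (unitT G c y)) = fun _ => 1 :=
    funext fun y => minner_unitT_self hpd (hreg y)
  rw [h0] at h1
  have h2 := h1.unique (hasDerivAt_const x (1 : ℝ))
  have h3 := mnorm_mul_minner_meanCurv hpd hT (hreg x) (unitT G c x)
  rw [minner_comm (hpd (c x)).apply_comm (deriv (unitT G c) x)] at h2
  have hs := smul_unitT hpd (hreg x)
  have hv := mnorm_pos (hpd (c x)) (hreg x)
  generalize mnorm (G (c x)) (deriv c x) = v at *
  rw [hs] at h2 h3
  simp only [metricDeriv_smul, minner_smul_matrix, minner_smul_right, minner_smul_left] at h2 h3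
  refine (mul_eq_zero.1 (?_ : v * _ = 0)).resolve_left hv.ne'
  linarith

/-- First variation of the length element when the variation field is the mean curvature. -/
theorem first_variation_meanCurv (hG : ∀ α β, Differentiable ℝ fun q => G q α β)
    (hpd : ∀ p, (G p).PosDef) (hc : Differentiable ℝ c) (hc' : Differentiable ℝ (deriv c))
    (hreg : ∀ y, deriv c y ≠ 0) {V' : Fin m → ℝ} (hV : HasDerivAt (meanCurv G c) V' x) :
    (1 / 2) * minner (metricDeriv G (c x) (meanCurv G c x)) (deriv c x) (deriv c x)
        + minner (G (c x)) (deriv c x) V'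
      = -(mnorm (G (c x)) (deriv c x) ^ 2
          * minner (G (c x)) (meanCurv G c x) (meanCurv G c x)) := by
  have hT := differentiableAt_unitT hG hpd (hc x) (hc' x) (hreg x)
  have h1 := hasDerivAt_minner hG (hc x).hasDerivAt hT.hasDerivAt hV
  rw [funext fun y => minner_unitT_meanCurv (x := y) hG hpd hc hc' hreg] at h1
  have h2 := h1.unique (hasDerivAt_const x (0 : ℝ))
  have h3 := mnorm_mul_minner_meanCurv hpd hT (hreg x) (meanCurv G c x)
  have hs := smul_unitT hpd (hreg x)
  rw [minner_comm (hpd (c x)).apply_comm (deriv (unitT G c) x),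
    minner_comm (metricDeriv_apply_comm (fun p => (hpd p).apply_comm) _ _)] at h2
  generalize meanCurv G c x = H at *
  generalize mnorm (G (c x)) (deriv c x) = v at *
  rw [hs] at h2 h3 ⊢
  simp only [metricDeriv_smul, minner_smul_matrix, minner_smul_right, minner_smul_left]
    at h2 h3 ⊢
  linear_combination v * h2 + v * h3

end CurveInMetric

section MixedPartials

variable {E : Type*} [NormedAddCommGroup E] [NormedSpace ℝ E] {γ : ℝ → ℝ → E}

theorem hasDerivAt_fst_of_contDiff (hγ : ContDiff ℝ 2 fun q : ℝ × ℝ => γ q.1 q.2) (x t : ℝ) :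
    HasDerivAt (fun y => γ y t)
      (fderiv ℝ (fun q : ℝ × ℝ => γ q.1 q.2) (x, t) (1, 0)) x :=
  (hγ.differentiable (by norm_num) (x, t)).hasFDerivAt.comp_hasDerivAt (f := fun y => (y, t)) x
    ((hasDerivAt_id x).prodMk (hasDerivAt_const x t))

theorem hasDerivAt_snd_of_contDiff (hγ : ContDiff ℝ 2 fun q : ℝ × ℝ => γ q.1 q.2) (x t : ℝ) :
    HasDerivAt (γ x) (fderiv ℝ (fun q : ℝ × ℝ => γ q.1 q.2) (x, t) (0, 1)) t :=
  (hγ.differentiable (by norm_num) (x, t)).hasFDerivAt.comp_hasDerivAt (f := fun s => (x, s)) t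
    ((hasDerivAt_const t x).prodMk (hasDerivAt_id t))

theorem exists_hasDerivAt_mixed_partials (hγ : ContDiff ℝ 2 fun q : ℝ × ℝ => γ q.1 q.2)
    (x t : ℝ) :
    ∃ w, HasDerivAt (fun s => deriv (fun y => γ y s) x) w t ∧
      HasDerivAt (fun y => deriv (γ y) t) w x := by
  set F : ℝ × ℝ → E := fun q => γ q.1 q.2 with hF
  have hd : DifferentiableAt ℝ (fderiv ℝ F) (x, t) :=
    (hγ.fderiv_right (m := 1) (by norm_num)).differentiable (by norm_num) (x, t)
  have hsymm : IsSymmSndFDerivAt ℝ F (x, t) :=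
    hγ.contDiffAt.isSymmSndFDerivAt (by simp)
  refine ⟨fderiv ℝ (fderiv ℝ F) (x, t) (0, 1) (1, 0), ?_, ?_⟩
  · rw [funext fun s => (hasDerivAt_fst_of_contDiff hγ x s).deriv]
    have h : HasDerivAt (fun s => fderiv ℝ F (x, s)) (fderiv ℝ (fderiv ℝ F) (x, t) (0, 1)) t :=
      hd.hasFDerivAt.comp_hasDerivAt (f := fun s => (x, s)) t
        ((hasDerivAt_const t x).prodMk (hasDerivAt_id t))
    simpa using h.clm_apply (hasDerivAt_const t ((1 : ℝ), (0 : ℝ)))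
  · rw [funext fun y => (hasDerivAt_snd_of_contDiff hγ y t).deriv, hsymm]
    have h : HasDerivAt (fun y => fderiv ℝ F (y, t)) (fderiv ℝ (fderiv ℝ F) (x, t) (1, 0)) x :=
      hd.hasFDerivAt.comp_hasDerivAt (f := fun y => (y, t)) x
        ((hasDerivAt_id x).prodMk (hasDerivAt_const x t))
    simpa using h.clm_apply (hasDerivAt_const x ((0 : ℝ), (1 : ℝ)))

end MixedPartials

section WarpedProduct

variable {n : ℕ} {g : (Fin n → ℝ) → Matrix (Fin n) (Fin n) ℝ} {φ : ℝ → ℝ}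

theorem minner_gwR (p u v : Fin (n + 1) → ℝ) :
    minner (gwR g φ p) u v = u 0 * v 0
      + φ (p 0) ^ 2 * minner (g fun k => p k.succ) (fun i => u i.succ) (fun i => v i.succ) := by
  simp only [minner, gwR, Matrix.of_apply, Fin.sum_univ_succ, Fin.cases_zero, Fin.cases_succ,
    mul_zero, zero_mul, mul_one, zero_add, Finset.sum_const_zero, add_zero, Finset.mul_sum]
  congr 1
  refine Finset.sum_congr rfl fun i _ => Finset.sum_congr rfl fun j _ => ?_
  ring

theorem minner_gwR_er_right (p u : Fin (n + 1) → ℝ) : minner (gwR g φ p) u (er n) = u 0 := by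
  rw [minner_gwR]
  simp [er, minner]

theorem minner_gwR_er_left (p u : Fin (n + 1) → ℝ) : minner (gwR g φ p) (er n) u = u 0 := by
  rw [minner_gwR]
  simp [er, minner]

theorem posDef_gwR (hgpd : ∀ x, (g x).PosDef) (hφpos : ∀ r, 0 < φ r) (p : Fin (n + 1) → ℝ) :
    (gwR g φ p).PosDef := by
  refine Matrix.PosDef.of_dotProduct_mulVec_pos ?_ fun u hu => ?_
  · ext α β
    simp only [Matrix.conjTranspose_apply, star_trivial]
    induction α using Fin.cases <;> induction β using Fin.cases <;>
      simp [gwR, (hgpd _).apply_comm]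
  · rw [star_trivial, ← minner_eq_dotProduct, minner_gwR]
    have hφ := pow_pos (hφpos (p 0)) 2
    by_cases h : (fun i : Fin n => u i.succ) = 0
    · have h0 : u 0 ≠ 0 := fun h0 => hu <| funext <| Fin.cases h0 (congrFun h)
      rw [h]
      have : 0 < u 0 * u 0 := mul_self_pos.2 h0
      simpa [minner] using this
    · have := mul_pos hφ ((hgpd fun k => p k.succ).minner_self_pos h)
      nlinarith [mul_self_nonneg (u 0)]

theorem differentiable_gwR (hg : ∀ i j, Differentiable ℝ fun x => g x i j)
    (hφ : Differentiable ℝ φ) (α β : Fin (n + 1)) :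
    Differentiable ℝ fun q => gwR g φ q α β := by
  induction α using Fin.cases with
  | zero =>
    induction β using Fin.cases <;> simp [gwR]
  | succ i =>
    induction β using Fin.cases with
    | zero => simp [gwR]
    | succ j =>
      have h : Differentiable ℝ fun q : Fin (n + 1) → ℝ => g (fun k => q k.succ) i j :=
        (hg i j).comp (by fun_prop)
      simp only [gwR, Matrix.of_apply, Fin.cases_succ]
      fun_prop

theorem minner_metricDeriv_gwR_er (X p Y : Fin (n + 1) → ℝ) :
    minner (metricDeriv (gwR g φ) p X) (er n) Y = 0 := by
  have h (β) : metricDeriv (gwR g φ) p X 0 β = 0 := by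
    induction β using Fin.cases <;> simp [metricDeriv, gwR]
  simp [minner, er, Fin.sum_univ_succ, h]

theorem minner_metricDeriv_er (hg : ∀ i j, Differentiable ℝ fun x => g x i j)
    (hφ : Differentiable ℝ φ) (hφpos : ∀ r, 0 < φ r) (p X Y : Fin (n + 1) → ℝ) :
    minner (metricDeriv (gwR g φ) p (er n)) X Y
      = 2 * deriv (fun s => Real.log (φ s)) (p 0) * (minner (gwR g φ p) X Y - X 0 * Y 0) := by
  have hline : HasDerivAt (fun s : ℝ => p + s • er n) (er n) 0 := by
    simpa using ((hasDerivAt_id (0 : ℝ)).smul_const (er n)).const_add p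
  have h1 := hasDerivAt_minner (differentiable_gwR hg hφ) hline (hasDerivAt_const (0 : ℝ) X)
    (hasDerivAt_const (0 : ℝ) Y)
  have h0 : ∀ s : ℝ, minner (gwR g φ (p + s • er n)) X Y = X 0 * Y 0
      + φ (p 0 + s) ^ 2
        * minner (g fun k => p k.succ) (fun i => X i.succ) (fun i => Y i.succ) := by
    intro s
    rw [minner_gwR]
    simp [er]
  simp only [h0] at h1
  have hφ0 : HasDerivAt (fun s => φ (p 0 + s)) (deriv φ (p 0)) 0 := by
    have : HasDerivAt φ (deriv φ (p 0)) (p 0 + 0) := by simpa using (hφ (p 0)).hasDerivAt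
    exact this.comp_const_add (p 0) 0
  have h2 := ((hφ0.pow 2).mul_const
    (minner (g fun k => p k.succ) (fun i => X i.succ) (fun i => Y i.succ))).const_add (X 0 * Y 0)
  have h3 := h1.unique h2
  have hz (A : Matrix (Fin (n + 1)) (Fin (n + 1)) ℝ) (u : Fin (n + 1) → ℝ) :
      minner A 0 u = 0 ∧ minner A u 0 = 0 := by simp [minner]
  have hlog : deriv (fun s => Real.log (φ s)) (p 0) = deriv φ (p 0) / φ (p 0) :=
    ((hφ (p 0)).hasDerivAt.log (hφpos _).ne').deriv
  have hne := (hφpos (p 0)).ne'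
  simp only [(hz _ _).1, (hz _ _).2, add_zero, zero_smul] at h3
  rw [h3, hlog, minner_gwR]
  field_simp
  push_cast
  ring

theorem thetaR_eq_unitT (γ : ℝ → ℝ → Fin (n + 1) → ℝ) (x t : ℝ) :
    thetaR g φ γ x t = unitT (gwR g φ) (fun y => γ y t) x 0 :=
  minner_gwR_er_right _ _

theorem Tscal_unitT_zero (hg : ∀ i j, Differentiable ℝ fun x => g x i j)
    (hgpd : ∀ x, (g x).PosDef) (hφ : Differentiable ℝ φ) (hφpos : ∀ r, 0 < φ r)
    {c : ℝ → Fin (n + 1) → ℝ} {x : ℝ} (hT : DifferentiableAt ℝ (unitT (gwR g φ) c) x)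
    (hx : deriv c x ≠ 0) :
    Tscal (gwR g φ) c (fun y => unitT (gwR g φ) c y 0) x
      = meanCurv (gwR g φ) c x 0 + deriv (fun s => Real.log (φ s)) (c x 0)
          * (1 - unitT (gwR g φ) c x 0 ^ 2) := by
  have hpd := posDef_gwR (g := g) hgpd hφpos
  have h := mnorm_mul_minner_meanCurv hpd hT hx (er n)
  have hs := smul_unitT hpd hx
  have hv := (mnorm_pos (hpd (c x)) hx).ne'
  have h1 := minner_unitT_self hpd hx
  rw [minner_metricDeriv_gwR_er, minner_metricDeriv_gwR_er, minner_gwR_er_left,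
    minner_gwR_er_left, minner_metricDeriv_er hg hφ hφpos] at h
  rw [Tscal, (hasDerivAt_pi.1 hT.hasDerivAt 0).deriv]
  generalize mnorm (gwR g φ (c x)) (deriv c x) = v at *
  rw [hs, minner_smul_left, h1] at h
  simp only [Pi.smul_apply, smul_eq_mul] at h
  field_simp
  linear_combination -h

end WarpedProduct

/-- Evolution equation of the angle function `Θ_R` along a curve shortening flow
in the right warped product. -/
theorem stmt11 {n : ℕ} (hn : 1 ≤ n)
    (g : (Fin n → ℝ) → Matrix (Fin n) (Fin n) ℝ)
    (hg : ∀ i j, ContDiff ℝ (⊤ : ℕ∞) fun x => g x i j)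
    (hgpd : ∀ x, (g x).PosDef)
    (φ : ℝ → ℝ) (hφ : ContDiff ℝ (⊤ : ℕ∞) φ) (hφpos : ∀ r, 0 < φ r)
    (t₀ : ℝ) (γ : ℝ → ℝ → Fin (n + 1) → ℝ)
    (hγ : ContDiff ℝ (⊤ : ℕ∞) fun q : ℝ × ℝ => γ q.1 q.2)
    (hreg : ∀ x t, deriv (fun y => γ y t) x ≠ 0)
    (hflow : ∀ x : ℝ, ∀ t ∈ Set.Ico (0 : ℝ) t₀,
      deriv (γ x) t = meanCurv (gwR g φ) (fun y => γ y t) x)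
    (x : ℝ) (t : ℝ) (ht : t ∈ Set.Ico (0 : ℝ) t₀) :
    deriv (fun s => thetaR g φ γ x s) t
      = lapScal (gwR g φ) (fun y => γ y t) (fun y => thetaR g φ γ y t) x
        + minner (gwR g φ (γ x t)) (meanCurv (gwR g φ) (fun y => γ y t) x)
            (meanCurv (gwR g φ) (fun y => γ y t) x) * thetaR g φ γ x t
        + 2 * deriv (fun s => Real.log (φ s)) (γ x t 0) * thetaR g φ γ x t
            * Tscal (gwR g φ) (fun y => γ y t) (fun y => thetaR g φ γ y t) x
        - deriv (deriv fun s => Real.log (φ s)) (γ x t 0) * thetaR g φ γ x t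
            * (1 - (thetaR g φ γ x t) ^ 2) := by
  have hg' : ∀ i j, Differentiable ℝ fun x => g x i j :=
    fun i j => (hg i j).differentiable (by simp)
  have hφ' : Differentiable ℝ φ := hφ.differentiable (by simp)
  have hγ2 : ContDiff ℝ 2 fun q : ℝ × ℝ => γ q.1 q.2 := by
    exact_mod_cast contDiff_infty.1 hγ 2
  have hG := differentiable_gwR hg' hφ'
  have hpd := posDef_gwR (g := g) hgpd hφpos
  have hc : Differentiable ℝ fun y => γ y t :=
    fun y => (hasDerivAt_fst_of_contDiff hγ2 y t).differentiableAt
  have hc' : Differentiable ℝ (deriv fun y => γ y t) := by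
    have h : ContDiff ℝ 2 fun y => γ y t :=
      hγ2.comp (contDiff_id.prodMk contDiff_const : ContDiff ℝ 2 fun y : ℝ => (y, t))
    have h1 : ContDiff ℝ (1 + 1) fun y => γ y t := by norm_num; exact h
    exact (contDiff_succ_iff_deriv.1 h1).2.2.differentiable (by norm_num)
  have hT : Differentiable ℝ (unitT (gwR g φ) fun y => γ y t) :=
    fun y => differentiableAt_unitT hG hpd (hc y) (hc' y) (hreg y t)
  obtain ⟨w, hwt, hwx⟩ := exists_hasDerivAt_mixed_partials hγ2 x t
  rw [funext fun y => hflow y t ht] at hwx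
  have hγt : HasDerivAt (γ x) (meanCurv (gwR g φ) (fun y => γ y t) x) t := by
    rw [← hflow x t ht]
    exact (hasDerivAt_snd_of_contDiff hγ2 x t).differentiableAt.hasDerivAt
  have hmt := hasDerivAt_mnorm hG hpd hγt hwt (hreg x t)
  rw [first_variation_meanCurv hG hpd hc hc' (fun y => hreg y t) hwx] at hmt
  have hv := (mnorm_pos (hpd (γ x t)) (hreg x t)).ne'
  have hΘt := (hmt.inv hv).mul (hasDerivAt_pi.1 hwt 0)
  have hTscal (y : ℝ) := Tscal_unitT_zero hg' hgpd hφ' hφpos (hT y) (hreg y t)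
  have hΘx := hasDerivAt_pi.1 (hT x).hasDerivAt 0
  have hlog : DifferentiableAt ℝ (deriv fun s => Real.log (φ s)) (γ x t 0) := by
    have h : ContDiff ℝ (1 + 1) fun s => Real.log (φ s) :=
      (by exact_mod_cast contDiff_infty.1 hφ 2 : ContDiff ℝ (1 + 1) φ).log fun s => (hφpos s).ne'
    exact (contDiff_succ_iff_deriv.1 h).2.2.differentiable (by norm_num) _
  have hκ := hlog.hasDerivAt.comp (h := fun y => γ y t 0) x
    (hasDerivAt_pi.1 (hc x).hasDerivAt 0)
  have hTT := (hasDerivAt_pi.1 hwx 0).add (hκ.mul ((hΘx.pow 2).const_sub 1))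
  have hΘ : (fun s => thetaR g φ γ x s) = fun s =>
      (mnorm (gwR g φ (γ x s)) (deriv (fun y => γ y s) x))⁻¹ * deriv (fun y => γ y s) x 0 :=
    funext fun s => thetaR_eq_unitT γ x s
  rw [hΘ]
  simp only [thetaR_eq_unitT]
  have hΔ := congrArg ((mnorm (gwR g φ (γ x t)) (deriv (fun y => γ y t) x))⁻¹ * ·) hTT.deriv
  refine hΘt.deriv.trans ?_
  have hTx := hTscal x
  rw [Tscal, hΘx.deriv] at hTx
  have hs := congrFun (smul_unitT hpd (hreg x t)) 0
  simp only [Pi.smul_apply, smul_eq_mul] at hs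
  rw [lapScal, funext hTscal]
  beta_reduce
  rw [← hTx, Tscal]
  refine Eq.trans ?_ (congrArg (fun z => z + _ + _ - _) hΔ.symm)
  simp only [Function.comp_apply, Pi.inv_apply, Pi.pow_apply]
  rw [hs]
  generalize mnorm (gwR g φ (γ x t)) (deriv (fun y => γ y t) x) = v at *
  field_simp
  ring


end
end
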